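/- arXiv:2204.03459 — 2 statements merged into one kernel-verified Lean document; each statement's English description precedes it below -/
import Mathlib

section
/- Let V be a mixed lattice vector space whose specific positive cone V_sp = {x : x ≽ 0} is generating. If A ⊆ V is an absorbing set, then MS₁(A) and MS₂(A) are absorbing. -/
/-- A mixed lattice vector space: a real vector space with two partial orders
(the initial order `le` and the specific order `sle`), each making it a partially
ordered vector space, such that the mixed upper and lower envelopes `up` and `down`
exist, `sle` implies `le`, and the specific cone is a mixed lattice cone. -/
structure MixedLattice (V : Type*) [AddCommGroup V] [Module ℝ V] where
  le : V → V → Prop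
  sle : V → V → Prop
  le_refl : ∀ x, le x x
  le_trans : ∀ {x y z}, le x y → le y z → le x z
  le_antisymm : ∀ {x y}, le x y → le y x → x = y
  sle_refl : ∀ x, sle x x
  sle_trans : ∀ {x y z}, sle x y → sle y z → sle x z
  sle_antisymm : ∀ {x y}, sle x y → sle y x → x = y
  le_add : ∀ {x y} (z : V), le x y → le (x + z) (y + z)
  le_smul : ∀ {a : ℝ}, 0 ≤ a → ∀ {x y}, le x y → le (a • x) (a • y)
  sle_add : ∀ {x y} (z : V), sle x y → sle (x + z) (y + z)
  sle_smul : ∀ {a : ℝ}, 0 ≤ a → ∀ {x y}, sle x y → sle (a • x) (a • y)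
  /-- the mixed upper envelope `x ⌣ y` -/
  up : V → V → V
  /-- the mixed lower envelope `x ⌢ y` -/
  down : V → V → V
  up_mem₁ : ∀ x y, sle x (up x y)
  up_mem₂ : ∀ x y, le y (up x y)
  up_min : ∀ x y w, sle x w → le y w → le (up x y) w
  down_mem₁ : ∀ x y, sle (down x y) x
  down_mem₂ : ∀ x y, le (down x y) y
  down_max : ∀ x y w, sle w x → le w y → le w (down x y)
  sle_imp_le : ∀ {x y}, sle x y → le x y
  up_cone : ∀ {x y}, sle 0 x → sle 0 y → sle 0 (up x y)
  down_cone : ∀ {x y}, sle 0 x → sle 0 y → sle 0 (down x y)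

namespace MixedLattice

variable {V : Type*} [AddCommGroup V] [Module ℝ V] (M : MixedLattice V)

/-- the specific upper part `xᵘ = 0 ⌣ x` -/
def supp (x : V) : V := M.up 0 x

/-- the specific lower part `xˡ = 0 ⌣ (-x)` -/
def slowp (x : V) : V := M.up 0 (-x)

/-- the upper part `ᵘx = x ⌣ 0` -/
def upp (x : V) : V := M.up x 0

/-- the lower part `ˡx = (-x) ⌣ 0` -/
def lowp (x : V) : V := M.up (-x) 0

/-- the symmetric generalized absolute value `s(x) = (1/2)((x⌣(−x)) + ((−x)⌣x))` -/
noncomputable def sabs (x : V) : V := (1 / 2 : ℝ) • (M.up x (-x) + M.up (-x) x)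

/-- the type 1 mixed-full hull `MF₁(A) = {y : x ≼ y ≤ z for some x, z ∈ A}` -/
def MF1 (A : Set V) : Set V := {y | ∃ x ∈ A, ∃ z ∈ A, M.sle x y ∧ M.le y z}

/-- the type 2 mixed-full hull `MF₂(A) = {y : x ≤ y ≼ z for some x, z ∈ A}` -/
def MF2 (A : Set V) : Set V := {y | ∃ x ∈ A, ∃ z ∈ A, M.le x y ∧ M.sle y z}

/-- `MS₁(A) = {y : −s(x) ≼ y ≤ s(x) for some x ∈ A}` -/
def MS1 (A : Set V) : Set V := {y | ∃ x ∈ A, M.sle (-M.sabs x) y ∧ M.le y (M.sabs x)}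

/-- `MS₂(A) = {y : −s(x) ≤ y ≼ s(x) for some x ∈ A}` -/
def MS2 (A : Set V) : Set V := {y | ∃ x ∈ A, M.le (-M.sabs x) y ∧ M.sle y (M.sabs x)}

/-- a set is symmetric-solid if `x ∈ A` and `s(y) ≤ s(x)` imply `y ∈ A` -/
def SymmSolid (A : Set V) : Prop := ∀ x ∈ A, ∀ y, M.le (M.sabs y) (M.sabs x) → y ∈ A

/-- a set is (≤)-full if `x, y ∈ S` and `y ≤ z ≤ x` imply `z ∈ S` -/
def LeFull (S : Set V) : Prop := ∀ x ∈ S, ∀ y ∈ S, ∀ z, M.le y z → M.le z x → z ∈ S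

/-- a set is (≼)-full if `x, y ∈ S` and `y ≼ z ≼ x` imply `z ∈ S` -/
def SleFull (S : Set V) : Prop := ∀ x ∈ S, ∀ y ∈ S, ∀ z, M.sle y z → M.sle z x → z ∈ S

/-- a linear subspace, as a set -/
def IsSubspace (S : Set V) : Prop :=
  (0 : V) ∈ S ∧ (∀ x ∈ S, ∀ y ∈ S, x + y ∈ S) ∧ ∀ (a : ℝ), ∀ x ∈ S, a • x ∈ S

/-- a mixed lattice subspace -/
def IsMLSubspace (S : Set V) : Prop :=
  IsSubspace S ∧ ∀ x ∈ S, ∀ y ∈ S, M.up x y ∈ S ∧ M.down x y ∈ S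

section Topology

variable [TopologicalSpace V]

/-- uniform continuity of a map `V → V` with respect to a vector topology -/
def UnifCont (f : V → V) : Prop :=
  ∀ W ∈ nhds (0 : V), ∃ U ∈ nhds (0 : V), ∀ x y : V, x - y ∈ U → f x - f y ∈ W

/-- uniform continuity of a map `V × V → V` with respect to a vector topology -/
def UnifCont2 (g : V → V → V) : Prop :=
  ∀ W ∈ nhds (0 : V), ∃ U ∈ nhds (0 : V),
    ∀ x x' y y' : V, x - x' ∈ U → y - y' ∈ U → g x y - g x' y' ∈ W

/-- the topology is locally mixed-full: every neighborhood of zero contains a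
type 1 mixed-full neighborhood of zero -/
def LocallyMixedFull : Prop :=
  ∀ U ∈ nhds (0 : V), ∃ W ∈ nhds (0 : V), W ⊆ U ∧ M.MF1 W = W

/-- the topology has a neighborhood base at zero of symmetric-solid sets -/
def LocallySymmSolid : Prop :=
  ∀ U ∈ nhds (0 : V), ∃ W ∈ nhds (0 : V), W ⊆ U ∧ M.SymmSolid W

/-- the topology has a neighborhood base at zero of (≤)-full sets -/
def LocallyLeFull : Prop :=
  ∀ U ∈ nhds (0 : V), ∃ W ∈ nhds (0 : V), W ⊆ U ∧ M.LeFull W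

/-- the mixed lattice operations are continuous at zero -/
def ContAtZero : Prop :=
  ContinuousAt (fun p : V × V => M.up p.1 p.2) ((0 : V), (0 : V)) ∧
  ContinuousAt (fun p : V × V => M.down p.1 p.2) ((0 : V), (0 : V))

end Topology

end MixedLattice

namespace MixedLattice

variable {V : Type*} [AddCommGroup V] [Module ℝ V] (M : MixedLattice V)

theorem sle_of_sub_nonneg {x y : V} (h : M.sle 0 (y - x)) : M.sle x y := by
  simpa using M.sle_add x h

theorem sle_neg_self_of_nonneg {u : V} (hu : M.sle 0 u) : M.sle (-u) u := by
  refine M.sle_trans ?_ hu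
  simpa using M.sle_add (-u) hu

theorem sle_neg_neg {x y : V} (h : M.sle x y) : M.sle (-y) (-x) := by
  convert M.sle_add (-x - y) h using 1 <;> abel

theorem sabs_neg (x : V) : M.sabs (-x) = M.sabs x := by
  simp only [sabs, neg_neg, add_comm]

theorem sabs_of_nonneg {u : V} (hu : M.sle 0 u) : M.sabs u = u := by
  have hneg := M.sle_neg_self_of_nonneg hu
  have h₁ : M.up u (-u) = u :=
    M.le_antisymm (M.up_min _ _ _ (M.sle_refl u) (M.sle_imp_le hneg))
      (M.sle_imp_le (M.up_mem₁ _ _))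
  have h₂ : M.up (-u) u = u :=
    M.le_antisymm (M.up_min _ _ _ hneg (M.le_refl u)) (M.up_mem₂ _ _)
  rw [sabs, h₁, h₂, ← two_smul ℝ u, smul_smul]
  norm_num

theorem sle_sabs_smul {u v : V} (hu : M.sle 0 u) (hl : M.sle (-u) v) (hr : M.sle v u) (c : ℝ) :
    M.sle (-M.sabs (c • u)) (c • v) ∧ M.sle (c • v) (M.sabs (c • u)) := by
  have key : ∀ {d : ℝ}, 0 ≤ d → M.sle (-M.sabs (d • u)) (d • v) ∧
      M.sle (d • v) (M.sabs (d • u)) := by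
    intro d hd
    rw [M.sabs_of_nonneg (by simpa using M.sle_smul hd hu)]
    exact ⟨by simpa using M.sle_smul hd hl, M.sle_smul hd hr⟩
  rcases le_total 0 c with hc | hc
  · exact key hc
  · obtain ⟨h₁, h₂⟩ := key (neg_nonneg.mpr hc)
    rw [neg_smul, neg_smul, M.sabs_neg] at h₁ h₂
    exact ⟨by simpa using M.sle_neg_neg h₂, by simpa using M.sle_neg_neg h₁⟩

/-- If the specific cone is generating and `A` is absorbing, then so is every set containing all
`y` with `−s(x) ≼ y ≼ s(x)` for some `x ∈ A`. -/
theorem absorbent_of_sle_sabs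
    (hgen : ∀ v : V, ∃ a b : V, M.sle 0 a ∧ M.sle 0 b ∧ v = a - b)
    {A B : Set V} (habs : Absorbent ℝ A)
    (hB : ∀ x ∈ A, ∀ y, M.sle (-M.sabs x) y → M.sle y (M.sabs x) → y ∈ B) :
    Absorbent ℝ B := by
  intro v
  obtain ⟨a, b, ha, hb, rfl⟩ := hgen v
  have hu : M.sle 0 (a + b) := M.sle_trans hb (by simpa using M.sle_add b ha)
  have hl : M.sle (-(a + b)) (a - b) := M.sle_of_sub_nonneg <| by
    convert M.sle_smul zero_le_two ha using 1
    · simp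
    · rw [two_smul]; abel
  have hr : M.sle (a - b) (a + b) := M.sle_of_sub_nonneg <| by
    convert M.sle_smul zero_le_two hb using 1
    · simp
    · rw [two_smul]; abel
  filter_upwards [habs (a + b), Bornology.eventually_ne_cobounded (0 : ℝ)] with c hc hc0
  rw [Set.singleton_subset_iff, Set.mem_smul_set_iff_inv_smul_mem₀ hc0] at hc ⊢
  obtain ⟨h₁, h₂⟩ := M.sle_sabs_smul hu hl hr c⁻¹
  exact hB _ hc _ h₁ h₂

end MixedLattice

/-- if the specific cone is generating and `A` is absorbing, then
`MS₁(A)` and `MS₂(A)` are absorbing. -/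
theorem stmt_7 {V : Type*} [AddCommGroup V] [Module ℝ V] (M : MixedLattice V)
    (hgen : ∀ v : V, ∃ a b : V, M.sle 0 a ∧ M.sle 0 b ∧ v = a - b)
    (A : Set V) (habs : Absorbent ℝ A) :
    Absorbent ℝ (M.MS1 A) ∧ Absorbent ℝ (M.MS2 A) := by
  exact ⟨M.absorbent_of_sle_sabs hgen habs fun x hx _ h₁ h₂ => ⟨x, hx, h₁, M.sle_imp_le h₂⟩,
    M.absorbent_of_sle_sabs hgen habs fun x hx _ h₁ h₂ => ⟨x, hx, M.sle_imp_le h₁, h₂⟩⟩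
end

section
/- Let (V, ≤, ≼) be a mixed lattice vector space which is a lattice with respect to the initial order ≤, and let τ be a locally symmetric-solid vector topology on V. Then τ has a neighborhood base at zero consisting of (≤)-solid sets, i.e., τ is a locally solid Riesz space topology on (V, ≤). -/
namespace MixedLattice

variable {V : Type*} [AddCommGroup V] [Module ℝ V] (M : MixedLattice V)

theorem le_add_add {a b c d : V} (hab : M.le a b) (hcd : M.le c d) : M.le (a + c) (b + d) := by
  have h := M.le_add b hcd
  rw [add_comm c b, add_comm d b] at h
  exact M.le_trans (M.le_add c hab) h

theorem sle_add_add {a b c d : V} (hab : M.sle a b) (hcd : M.sle c d) :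
    M.sle (a + c) (b + d) := by
  have h := M.sle_add b hcd
  rw [add_comm c b, add_comm d b] at h
  exact M.sle_trans (M.sle_add c hab) h

/-- The symmetric absolute value is positive in the specific order. -/
theorem sle_zero_sabs (x : V) : M.sle 0 (M.sabs x) := by
  have h := M.sle_smul (a := 1 / 2) (by norm_num)
    (M.sle_add_add (M.up_mem₁ x (-x)) (M.up_mem₁ (-x) x))
  rwa [add_neg_cancel, smul_zero] at h

/-- The symmetric absolute value is an upper bound of every common lower bound of
the two mixed envelopes it averages. -/
theorem le_sabs_of_le_up {x a : V} (h₁ : M.le a (M.up x (-x))) (h₂ : M.le a (M.up (-x) x)) :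
    M.le a (M.sabs x) := by
  have h := M.le_smul (a := 1 / 2) (by norm_num) (M.le_add_add h₁ h₂)
  have e : (1 / 2 : ℝ) • (a + a) = a := by module
  rwa [e] at h

theorem le_sabs (x : V) : M.le x (M.sabs x) :=
  M.le_sabs_of_le_up (M.sle_imp_le (M.up_mem₁ _ _)) (M.up_mem₂ _ _)

theorem neg_le_sabs (x : V) : M.le (-x) (M.sabs x) :=
  M.le_sabs_of_le_up (M.up_mem₂ _ _) (M.sle_imp_le (M.up_mem₁ _ _))

theorem up_half_le {y p : V} (hp : M.sle 0 p) (hy : M.le (-y) p) :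
    M.le (M.up ((1 / 2 : ℝ) • y) (-((1 / 2 : ℝ) • y))) (p + (1 / 2 : ℝ) • y) := by
  apply M.up_min
  · simpa using M.sle_add ((1 / 2 : ℝ) • y) hp
  · have h := M.le_add ((1 / 2 : ℝ) • y) hy
    have e : -y + (1 / 2 : ℝ) • y = -((1 / 2 : ℝ) • y) := by module
    rwa [e] at h

/-- If `-p ≤ y ≤ p` with `p` specifically positive, then `s(y / 2) ≤ p`. -/
theorem sabs_half_le {y p : V} (hp : M.sle 0 p) (hy : M.le y p) (hy' : M.le (-y) p) :
    M.le (M.sabs ((1 / 2 : ℝ) • y)) p := by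
  have h₂ := M.up_half_le (y := -y) hp (by rwa [neg_neg])
  rw [smul_neg, neg_neg] at h₂
  have h := M.le_smul (a := 1 / 2) (by norm_num) (M.le_add_add (M.up_half_le hp hy') h₂)
  have e : (1 / 2 : ℝ) • (p + (1 / 2 : ℝ) • y + (p + -((1 / 2 : ℝ) • y))) = p := by module
  rwa [e] at h

end MixedLattice

/-- if the mixed lattice space is a lattice with respect to the initial
order (witnessed by a binary supremum `lsup` for `≤`) and the vector topology is locally
symmetric-solid, then the topology has a neighborhood base at zero of (≤)-solid sets.
Here `|x| = lsup x (−x)`. -/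
theorem stmt_18 {V : Type*} [AddCommGroup V] [Module ℝ V] (M : MixedLattice V)
    [TopologicalSpace V] [ContinuousAdd V] [ContinuousSMul ℝ V]
    (lsup : V → V → V)
    (hsup : ∀ x y : V, M.le x (lsup x y) ∧ M.le y (lsup x y) ∧
      ∀ w : V, M.le x w → M.le y w → M.le (lsup x y) w)
    (hss : M.LocallySymmSolid) :
    ∀ U ∈ nhds (0 : V), ∃ W ∈ nhds (0 : V), W ⊆ U ∧
      ∀ x ∈ W, ∀ y : V, M.le (lsup y (-y)) (lsup x (-x)) → y ∈ W := by
  intro U hU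
  have hdouble : Filter.Tendsto (fun z : V => (2 : ℝ) • z) (nhds 0) (nhds 0) := by
    simpa using (continuous_const_smul (2 : ℝ)).tendsto (0 : V)
  obtain ⟨S, hS, hSU, hsolid⟩ := hss _ (hdouble hU)
  refine ⟨{y | ∃ x ∈ S, M.le (lsup y (-y)) (lsup x (-x))}, ?_, ?_, ?_⟩
  · exact Filter.mem_of_superset hS fun x hx => ⟨x, hx, M.le_refl _⟩
  · rintro y ⟨x, hx, hyx⟩
    have hxs : M.le (lsup x (-x)) (M.sabs x) :=
      (hsup x (-x)).2.2 _ (M.le_sabs x) (M.neg_le_sabs x)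
    have hys := M.le_trans hyx hxs
    have hmem : (1 / 2 : ℝ) • y ∈ S := hsolid x hx _ <|
      M.sabs_half_le (M.sle_zero_sabs x) (M.le_trans (hsup y (-y)).1 hys)
        (M.le_trans (hsup y (-y)).2.1 hys)
    have h : (2 : ℝ) • (1 / 2 : ℝ) • y ∈ U := hSU hmem
    have e : (2 : ℝ) • (1 / 2 : ℝ) • y = y := by module
    rwa [e] at h
  · rintro x ⟨z, hz, hxz⟩ y hyx
    exact ⟨z, hz, M.le_trans hyx hxz⟩
end
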